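/- arXiv:2311.11332 — 2 statements merged into one kernel-verified Lean document; each statement's English description precedes it below -/
import Mathlib

section
/- Let G be a complete graph on n vertices with nonnegative edge weights, where 4 divides n. Let C*_4 be a maximum-weight 4-cycle packing and M* a maximum-weight perfect matching of G. Then the edge set of C*_4 can be partitioned into two perfect matchings M_b and M_r (of size n/2 each) such that in the multigraph on V with edge multiset M_b ∪ M*, every connected component is a cycle whose length is divisible by 4. -/
/-- Two fixed-point-free involutions admit a common proper two-colouring. -/
lemma exists_common_two_coloring {α : Type*} [LinearOrder α] (P Q : Equiv.Perm α)
    (hP : ∀ v, P (P v) = v) (hP1 : ∀ v, P v ≠ v) (hQ : ∀ v, Q (Q v) = v) (hQ1 : ∀ v, Q v ≠ v) :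
    ∃ z : α → Bool, (∀ v, z (P v) = !z v) ∧ (∀ v, z (Q v) = !z v) := by
  have hPP : P * P = 1 := Equiv.ext hP
  have hPinv : P⁻¹ = P := inv_eq_of_mul_eq_one_right hPP
  have hQinv : Q⁻¹ = Q := inv_eq_of_mul_eq_one_right (Equiv.ext hQ)
  have hconj : ∀ k : ℤ, P * (Q * P) ^ k * P = (Q * P) ^ (-k) := by
    intro k
    have h : P * (Q * P) * P⁻¹ = (Q * P)⁻¹ := by
      rw [mul_inv_rev, hPinv, hQinv, mul_assoc, mul_assoc, hPP, mul_one]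
    calc P * (Q * P) ^ k * P = P * (Q * P) ^ k * P⁻¹ := by rw [hPinv]
      _ = (Q * P) ^ (-k) := by rw [← conj_zpow, h, inv_zpow, zpow_neg]
  have hcomm : ∀ (k : ℤ) (v : α), P (((Q * P) ^ k) v) = ((Q * P) ^ (-k)) (P v) := by
    intro k v
    rw [← hconj k, Equiv.Perm.mul_apply, Equiv.Perm.mul_apply, hP]
  have hne : ∀ v, ¬ (Q * P).SameCycle v (P v) := by
    rintro v ⟨k, hk⟩
    obtain ⟨j, rfl | rfl⟩ := Int.even_or_odd' k
    · apply hP1 (((Q * P) ^ j) v)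
      rw [hcomm, ← hk, ← Equiv.Perm.mul_apply, ← zpow_add]
      congr 2
      ring
    · apply hQ1 (P (((Q * P) ^ j) v))
      rw [← Equiv.Perm.mul_apply Q P, hcomm, ← hk, ← Equiv.Perm.mul_apply,
        ← Equiv.Perm.mul_apply, ← zpow_add, ← zpow_one_add]
      congr 2
      ring
  let r : α → α := fun v => (Quotient.mk (Equiv.Perm.SameCycle.setoid (Q * P)) v).out
  have hr : ∀ u v, r u = r v ↔ (Q * P).SameCycle u v := fun u v =>
    Quotient.out_inj.trans (Quotient.eq (r := Equiv.Perm.SameCycle.setoid (Q * P)))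
  have hQP : ∀ v, (Q * P).SameCycle (Q v) (P v) := fun v => by
    have h : (Q * P) (P v) = Q v := by rw [Equiv.Perm.mul_apply, hP]
    rw [← h]
    exact Equiv.Perm.sameCycle_apply_left.2 (Equiv.Perm.SameCycle.refl _ _)
  have hzP : ∀ v, decide (r (P v) < r (P (P v))) = !decide (r v < r (P v)) := by
    intro v
    have h : r v ≠ r (P v) := fun h => hne v ((hr _ _).1 h)
    rw [hP, ← decide_not, decide_eq_decide, not_lt]
    exact ⟨le_of_lt, fun h' => lt_of_le_of_ne h' h.symm⟩
  refine ⟨fun v => decide (r v < r (P v)), hzP, fun v => ?_⟩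
  have h1 : r (Q v) = r (P v) := (hr _ _).2 (hQP v)
  have h2 : r (P (Q v)) = r (P (P v)) := by
    rw [hP]
    have h := hQP (Q v)
    rw [hQ] at h
    exact ((hr _ _).2 h).symm
  rw [← hzP v]
  simp only [h1, h2]

/-- If `p` alternates along the orbits of `C`, pairing `v` with `C v` when `p v` holds and with
`C⁻¹ v` otherwise is an involution. -/
lemma involutive_alternating_step {α : Type*} (C : Equiv.Perm α) (p : α → Bool)
    (hp : ∀ v, p (C v) = !p v) :
    Function.Involutive (fun v => if p v then C v else C⁻¹ v) := by
  intro v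
  have h := hp (C⁻¹ v)
  rw [show C (C⁻¹ v) = v from C.apply_symm_apply v] at h
  cases hv : p v <;> simp_all

/-- A map that reverses a two-colouring has only even minimal periods. -/
lemma even_minimalPeriod_of_alternating {α : Type*} (f : α → α) (y : α → Bool)
    (hy : ∀ v, y (f v) = !y v) (v : α) : Even (Function.minimalPeriod f v) := by
  have h : ∀ k, y (f^[k] v) = y v ↔ Even k := by
    intro k
    induction k with
    | zero => simp
    | succ k ih =>
      rw [Function.iterate_succ_apply', hy, Nat.even_add_one, ← ih]
      cases y (f^[k] v) <;> cases y v <;> simp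
  rw [← h, Function.iterate_minimalPeriod]

open Finset

/-- Total weight of the `k`-cycle packing represented by a bijection
`f : Fin m × Fin k ≃ Fin n` (cycle `i` visits `f (i,0), f (i,1), …, f (i,k-1)` cyclically). -/
noncomputable def cycleW {n m k : ℕ} (w : Fin n → Fin n → ℝ) (f : Fin m × Fin k ≃ Fin n) : ℝ :=
  ∑ i : Fin m, ∑ j : Fin k, w (f (i, j)) (f (i, finRotate k j))

/-- Total weight of the `k`-path packing represented by a bijection
`f : Fin m × Fin k ≃ Fin n` (path `i` is `f (i,0), f (i,1), …, f (i,k-1)`). -/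
noncomputable def pathW {n m k : ℕ} (w : Fin n → Fin n → ℝ) (f : Fin m × Fin k ≃ Fin n) : ℝ :=
  ∑ i : Fin m, ∑ j : Fin k,
    if (j : ℕ) + 1 < k then w (f (i, j)) (f (i, finRotate k j)) else 0

/-- Weight of the Hamiltonian cycle represented by the vertex ordering `g : Fin n ≃ Fin n`. -/
noncomputable def hamW {n : ℕ} (w : Fin n → Fin n → ℝ) (g : Fin n ≃ Fin n) : ℝ :=
  ∑ j : Fin n, w (g j) (g (finRotate n j))

/-- `w̃` of a `k`-path packing: the total weight of the odd-position edges
`(v_{i1},v_{i2}), (v_{i3},v_{i4}), …` of each path. -/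
noncomputable def tildeW {n m k : ℕ} (w : Fin n → Fin n → ℝ) (f : Fin m × Fin k ≃ Fin n) : ℝ :=
  ∑ i : Fin m, ∑ j : Fin k,
    if (j : ℕ) % 2 = 0 then w (f (i, j)) (f (i, finRotate k j)) else 0

/-- Weight of a matching of size `p`, given by the endpoints `x (i,0)`, `x (i,1)` of each edge. -/
noncomputable def matchW {n p : ℕ} (w : Fin n → Fin n → ℝ) (x : Fin p × Fin 2 → Fin n) : ℝ :=
  ∑ i : Fin p, w (x (i, 0)) (x (i, 1))

/-- In a complete graph on `n = 4m` vertices with nonnegative edge weights, let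
`C*_4` be a maximum-weight 4-cycle packing (modelled as a permutation all of whose orbits are
4-cycles: `σ⁴ = 1`, no fixed points, no 2-orbits, with weight `Σ_v w(v, σ v)`) and let `M*` be
a maximum-weight perfect matching (a fixed-point-free involution, with weight
`(Σ_v w(v, μ v))/2`). Then the edges of `C*_4` can be partitioned into two perfect matchings
`M_b` and `M_r` (at each vertex `v`, one of the two incident cycle edges `{v, σ v}`,
`{v, σ⁻¹ v}` is blue and the other red) such that every component of the multigraph
`M_b ∪ M*` is a cycle of length divisible by 4; equivalently, every orbit of the permutation
`M* ∘ M_b` has even size. -/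
theorem stmt13 (n m : ℕ) (hn : n = 4 * m)
    (w : Fin n → Fin n → ℝ)
    (hnonneg : ∀ u v, 0 ≤ w u v) (hsymm : ∀ u v, w u v = w v u)
    (Cstar : Equiv.Perm (Fin n)) (hC4 : Cstar ^ 4 = 1)
    (hC1 : ∀ v, Cstar v ≠ v) (hC2 : ∀ v, Cstar (Cstar v) ≠ v)
    (hCmax : ∀ σ : Equiv.Perm (Fin n), σ ^ 4 = 1 → (∀ v, σ v ≠ v) → (∀ v, σ (σ v) ≠ v) →
      (∑ v, w v (σ v)) ≤ ∑ v, w v (Cstar v))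
    (Mstar : Equiv.Perm (Fin n)) (hM2 : Mstar ^ 2 = 1) (hM1 : ∀ v, Mstar v ≠ v)
    (hMmax : ∀ μ : Equiv.Perm (Fin n), μ ^ 2 = 1 → (∀ v, μ v ≠ v) →
      (∑ v, w v (μ v)) ≤ ∑ v, w v (Mstar v)) :
    ∃ Mb Mr : Equiv.Perm (Fin n),
      Mb ^ 2 = 1 ∧ (∀ v, Mb v ≠ v) ∧ Mr ^ 2 = 1 ∧ (∀ v, Mr v ≠ v) ∧
      (∀ v, (Mb v = Cstar v ∧ Mr v = Cstar⁻¹ v) ∨ (Mb v = Cstar⁻¹ v ∧ Mr v = Cstar v)) ∧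
      (∀ v, Even (Function.minimalPeriod (⇑(Mstar * Mb)) v)) := by
  have hM : ∀ v, Mstar (Mstar v) = v := fun v => by
    rw [← Equiv.Perm.mul_apply, ← sq, hM2, Equiv.Perm.one_apply]
  have hC : ∀ v, (Cstar * Cstar) ((Cstar * Cstar) v) = v := fun v => by
    rw [← Equiv.Perm.mul_apply, ← sq, ← sq, ← pow_mul, hC4, Equiv.Perm.one_apply]
  obtain ⟨x, hxM, hxC⟩ := exists_common_two_coloring Mstar (Cstar * Cstar) hM hM1 hC hC2
  have hCinv : ∀ v, Cstar (Cstar⁻¹ v) = v := Cstar.apply_symm_apply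
  have hinv1 : ∀ v, Cstar⁻¹ v ≠ v := fun v h => hC1 v (Equiv.Perm.inv_eq_iff_eq.1 h).symm
  set p : Fin n → Bool := fun v => x (Cstar v) == x v with hp_def
  have hp : ∀ v, p (Cstar v) = !p v := fun v => by
    have h := hxC v
    rw [Equiv.Perm.mul_apply] at h
    simp only [hp_def, h]
    cases x v <;> cases x (Cstar v) <;> rfl
  have hb := involutive_alternating_step Cstar p hp
  have hr := involutive_alternating_step Cstar (fun v => !p v) fun v => congrArg (!·) (hp v)
  have hxb : ∀ v, x (if p v then Cstar v else Cstar⁻¹ v) = x v := by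
    intro v
    have h := hp (Cstar⁻¹ v)
    rw [hCinv] at h
    cases hv : p v
    · have h' : p (Cstar⁻¹ v) = true := by simpa [hv] using h
      simp only [hp_def, hCinv, beq_iff_eq] at h'
      simpa using h'.symm
    · simpa [hp_def] using hv
  have hb1 : ∀ v, hb.toPerm _ v ≠ v := fun v => by
    simp only [Function.Involutive.coe_toPerm]
    split_ifs
    exacts [hC1 v, hinv1 v]
  have hr1 : ∀ v, hr.toPerm _ v ≠ v := fun v => by
    simp only [Function.Involutive.coe_toPerm]
    split_ifs
    exacts [hC1 v, hinv1 v]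
  obtain ⟨z, hzM, hzb⟩ := exists_common_two_coloring Mstar (hb.toPerm _) hM hM1 hb hb1
  refine ⟨hb.toPerm _, hr.toPerm _, ?_, hb1, ?_, hr1, fun v => ?_,
    even_minimalPeriod_of_alternating _ (fun v => xor (x v) (z v)) fun v => ?_⟩
  · rw [sq]
    exact Equiv.ext hb
  · rw [sq]
    exact Equiv.ext hr
  · simp only [Function.Involutive.coe_toPerm]
    cases p v <;> simp
  · have hx : x (hb.toPerm _ v) = x v := hxb v
    rw [Equiv.Perm.mul_apply, hxM, hzM, hzb, hx]
    cases x v <;> cases z v <;> rfl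
end

section
/- Let G be a complete graph on n vertices with nonnegative edge weights, where 4 divides n. Then there exists a 4-path packing P_4 of G whose edge set contains a maximum-weight perfect matching M*, with w(P_4) ≥ (1/2)·w(M*) + (1/2)·w(C*_4). -/
open Finset

/-- The other endpoint of the edge of the perfect matching `M` at `v`. -/
def mate {κ V : Type*} (M : κ × Fin 2 ≃ V) (v : V) : V :=
  M ((M.symm v).1, (M.symm v).2 + 1)

/-- The perfect matching that consists of the edges `(i, s i) – (i, s i + 1)` and
`(i, s i + 2) – (i, s i + 3)` of each 4-cycle `i`. -/
def blockPairing {ι : Type*} (s : ι → Fin 4) : (ι × Fin 2) × Fin 2 ≃ ι × Fin 4 :=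
  (Equiv.prodAssoc ι (Fin 2) (Fin 2)).trans
    (Equiv.prodShear (Equiv.refl ι) fun i =>
      (finProdFinEquiv (m := 2) (n := 2)).trans (Equiv.addLeft (s i)))

lemma blockPairing_apply {ι : Type*} (s : ι → Fin 4) (i : ι) (h k : Fin 2) :
    blockPairing s ((i, h), k) = (i, s i + ![![0, 1], ![2, 3]] h k) := by
  fin_cases h <;> fin_cases k <;> rfl

lemma mate_apply_zero {κ V : Type*} (M : κ × Fin 2 ≃ V) (j : κ) :
    mate M (M (j, 0)) = M (j, 1) := by
  simp [mate]

lemma mate_apply_one {κ V : Type*} (M : κ × Fin 2 ≃ V) (j : κ) :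
    mate M (M (j, 1)) = M (j, 0) := by
  simp [mate]

lemma exists_matching_edge {κ V : Type*} (M : κ × Fin 2 ≃ V) (v : V) :
    ∃ j, v = M (j, 0) ∨ v = M (j, 1) := by
  obtain ⟨⟨j, b⟩, rfl⟩ := M.surjective v
  refine ⟨j, ?_⟩
  fin_cases b <;> simp

lemma mate_mate {κ V : Type*} (M : κ × Fin 2 ≃ V) (v : V) : mate M (mate M v) = v := by
  obtain ⟨j, rfl | rfl⟩ := exists_matching_edge M v <;>
    simp only [mate_apply_zero, mate_apply_one]

lemma sum_matching {κ V R : Type*} [Fintype κ] [Fintype V] [AddCommMonoid R]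
    (M : κ × Fin 2 ≃ V) (g : V → R) :
    ∑ v, g v = ∑ j, (g (M (j, 0)) + g (M (j, 1))) := by
  rw [← M.sum_comp, Fintype.sum_prod_type]
  simp only [Fin.sum_univ_two]

lemma zmod_two_cases (a : ZMod 2) : a = 0 ∨ a = 1 := by
  revert a; decide

/-- One edge orientation of each 4-cycle can be chosen so that every edge set `P` of the perfect
matching whose vertex set is a union of chosen cycle edges has even cardinality. -/
lemma exists_blockPairing_even {κ ι : Type*} [Fintype κ] [Fintype ι]
    (e : κ × Fin 2 ≃ ι × Fin 4) :
    ∃ s : ι → Fin 4, ∀ P : κ → ZMod 2,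
      (∀ i, P (e.symm (i, s i)).1 = P (e.symm (i, s i + 1)).1 ∧
        P (e.symm (i, s i + 2)).1 = P (e.symm (i, s i + 3)).1) → ∑ j, P j = 0 := by
  classical
  suffices H : ∀ I : Finset ι, ∃ s : ι → Fin 4, ∀ P : κ → ZMod 2,
      (∀ i ∈ I, P (e.symm (i, s i)).1 = P (e.symm (i, s i + 1)).1 ∧
        P (e.symm (i, s i + 2)).1 = P (e.symm (i, s i + 3)).1) →
      (∀ i ∉ I, ∀ k, P (e.symm (i, k)).1 = P (e.symm (i, 0)).1) → ∑ j, P j = 0 by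
    obtain ⟨s, hs⟩ := H Finset.univ
    exact ⟨s, fun P hP => hs P (fun i _ => hP i) (by simp)⟩
  intro I
  induction I using Finset.induction_on with
  | empty =>
    refine ⟨0, fun P _ hP => ?_⟩
    have h1 := sum_matching e fun v => (P (e.symm v).1).val
    simp only [Equiv.symm_apply_apply, Fintype.sum_prod_type, Fin.sum_univ_four] at h1
    have h2 : ∑ i, 4 * (P (e.symm (i, 0)).1).val = ∑ j, 2 * (P j).val := by
      calc _ = _ := Finset.sum_congr rfl fun i _ => by
            rw [hP i (by simp) 1, hP i (by simp) 2, hP i (by simp) 3]; ring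
        _ = _ := h1
        _ = _ := Finset.sum_congr rfl fun j _ => by ring
    rw [← Finset.mul_sum, ← Finset.mul_sum] at h2
    have h3 : ∑ j, P j = ((∑ j, (P j).val : ℕ) : ZMod 2) := by
      rw [Nat.cast_sum]
      exact Finset.sum_congr rfl fun j _ => (ZMod.natCast_zmod_val _).symm
    rw [h3, ZMod.natCast_eq_zero_iff]
    omega
  | insert i I hi ih =>
    obtain ⟨s, hs⟩ := ih
    by_contra! hcon
    obtain ⟨P, hPI, hPc, hP⟩ := hcon (Function.update s i 0)
    obtain ⟨Q, hQI, hQc, hQ⟩ := hcon (Function.update s i 1)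
    have hne : ∀ k ∈ I, k ≠ i := fun k hk h => hi (h ▸ hk)
    have hPi := hPI i (Finset.mem_insert_self i I)
    have hQi := hQI i (Finset.mem_insert_self i I)
    have hPI' : ∀ k ∈ I, _ := fun k hk => hPI k (Finset.mem_insert_of_mem hk)
    have hQI' : ∀ k ∈ I, _ := fun k hk => hQI k (Finset.mem_insert_of_mem hk)
    simp only [Function.update_self, zero_add] at hPi hQi
    rw [show (1 : Fin 4) + 1 = 2 from rfl, show (1 : Fin 4) + 2 = 3 from rfl,
      show (1 : Fin 4) + 3 = 0 from rfl] at hQi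
    have hsplit : ∀ R : κ → ZMod 2, ∑ j, R j ≠ 0 →
        (∀ k ∈ I, R (e.symm (k, s k)).1 = R (e.symm (k, s k + 1)).1 ∧
          R (e.symm (k, s k + 2)).1 = R (e.symm (k, s k + 3)).1) →
        (∀ k ∉ insert i I, ∀ l, R (e.symm (k, l)).1 = R (e.symm (k, 0)).1) →
        ¬ ∀ l, R (e.symm (i, l)).1 = R (e.symm (i, 0)).1 := by
      intro R hR hRI hRc hRi
      refine hR (hs R hRI fun k hk => ?_)
      by_cases hki : k = i
      · subst hki; exact hRi
      · exact hRc k (by simp [hki, hk])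
    have hPs : ∀ k ∈ I, P (e.symm (k, s k)).1 = P (e.symm (k, s k + 1)).1 ∧
        P (e.symm (k, s k + 2)).1 = P (e.symm (k, s k + 3)).1 := fun k hk => by
      simpa only [Function.update_of_ne (hne k hk)] using hPI' k hk
    have hQs : ∀ k ∈ I, Q (e.symm (k, s k)).1 = Q (e.symm (k, s k + 1)).1 ∧
        Q (e.symm (k, s k + 2)).1 = Q (e.symm (k, s k + 3)).1 := fun k hk => by
      simpa only [Function.update_of_ne (hne k hk)] using hQI' k hk
    have hPn := hsplit P hP hPs hPc
    have hQn := hsplit Q hQ hQs hQc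
    have hsum := sum_matching e fun v => P (e.symm v).1 * Q (e.symm v).1
    simp only [Equiv.symm_apply_apply, CharTwo.add_self_eq_zero, Finset.sum_const_zero,
      Fintype.sum_prod_type] at hsum
    rw [Finset.sum_eq_single i _ (by simp)] at hsum
    · rw [Fin.sum_univ_four, ← hPi.1, ← hPi.2, ← hQi.1, hQi.2] at hsum
      have hfac : (P (e.symm (i, 0)).1 + P (e.symm (i, 2)).1) *
          (Q (e.symm (i, 0)).1 + Q (e.symm (i, 1)).1) = 0 := by
        rw [← hsum]; ring
      rcases mul_eq_zero.mp hfac with h | h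
      · rw [CharTwo.add_eq_zero] at h
        refine hPn fun l => ?_
        fin_cases l
        · rfl
        · exact hPi.1.symm
        · exact h.symm
        · exact hPi.2.symm.trans h.symm
      · rw [CharTwo.add_eq_zero] at h
        refine hQn fun l => ?_
        fin_cases l
        · rfl
        · exact h.symm
        · exact hQi.1.symm.trans h.symm
        · exact hQi.2
    · intro k _ hk
      by_cases hkI : k ∈ I
      · have hperm : ∑ l, P (e.symm (k, l)).1 * Q (e.symm (k, l)).1 =
            ∑ l, P (e.symm (k, s k + l)).1 * Q (e.symm (k, s k + l)).1 :=
          (Equiv.sum_comp (Equiv.addLeft (s k))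
            fun l => P (e.symm (k, l)).1 * Q (e.symm (k, l)).1).symm
        rw [hperm, Fin.sum_univ_four, add_zero, (hPs k hkI).1, (hPs k hkI).2, (hQs k hkI).1,
          (hQs k hkI).2, CharTwo.add_self_eq_zero, zero_add, CharTwo.add_self_eq_zero]
      · have hk' : k ∉ insert i I := by simp [hk, hkI]
        rw [Finset.sum_congr rfl fun l _ => by rw [hPc k hk' l, hQc k hk' l]]
        rw [Finset.sum_const, Finset.card_univ, Fintype.card_fin, nsmul_eq_mul]
        exact mul_eq_zero_of_left (by decide) _

/-- Two perfect matchings `M`, `A` whose union has only even `M`-alternating cycles admit a vertex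
colouring that is constant on the edges of `A` and bichromatic on the edges of `M`. -/
lemma exists_coloring_of_even {κ ι V : Type*} [Fintype κ] [Fintype V]
    (M : κ × Fin 2 ≃ V) (A : ι × Fin 2 ≃ V)
    (heven : ∀ P : κ → ZMod 2,
      (∀ a, P (M.symm (A (a, 0))).1 = P (M.symm (A (a, 1))).1) → ∑ j, P j = 0) :
    ∃ χ : V → ZMod 2, (∀ j, χ (M (j, 0)) + χ (M (j, 1)) = 1) ∧
      ∀ a, χ (A (a, 0)) = χ (A (a, 1)) := by
  classical
  let W : Submodule (ZMod 2) (V → ZMod 2) :=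
    { carrier := {χ | ∀ a, χ (A (a, 0)) = χ (A (a, 1))}
      add_mem' := fun {x y} hx hy a => by simp [hx a, hy a]
      zero_mem' := fun a => rfl
      smul_mem' := fun c x hx a => by simp [hx a] }
  let T : (V → ZMod 2) →ₗ[ZMod 2] (κ → ZMod 2) :=
    { toFun := fun χ j => χ (M (j, 0)) + χ (M (j, 1))
      map_add' := fun x y => by ext j; simp; ring
      map_smul' := fun c x => by ext j; simp; ring }
  by_cases hmem : (fun _ => 1 : κ → ZMod 2) ∈ W.map T
  · obtain ⟨χ, hχ, hT⟩ := hmem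
    exact ⟨χ, fun j => congrFun hT j, hχ⟩
  · exfalso
    obtain ⟨f, hf, hfW⟩ := Submodule.exists_dual_map_eq_bot_of_notMem hmem inferInstance
    let P : κ → ZMod 2 := fun j => f fun k => if j = k then 1 else 0
    have hfP : ∀ z, f z = ∑ j, z j * P j := fun z => f.pi_apply_eq_sum_univ z
    refine hf ?_
    rw [hfP]
    simp only [one_mul]
    refine heven P fun a => ?_
    let χ : V → ZMod 2 := Pi.single (A (a, 0)) 1 + Pi.single (A (a, 1)) 1
    have hχ : χ ∈ W := fun b => by
      simp only [χ, Pi.add_apply, Pi.single_apply, A.apply_eq_iff_eq, Prod.mk.injEq]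
      simp
    have h0 : f (T χ) = 0 := by
      have : f (T χ) ∈ (W.map T).map f := ⟨_, ⟨χ, hχ, rfl⟩, rfl⟩
      rwa [hfW, Submodule.mem_bot] at this
    have h1 := sum_matching M fun v => χ v * P (M.symm v).1
    simp only [Equiv.symm_apply_apply, ← add_mul] at h1
    rw [hfP] at h0
    have h2 := h1.trans h0
    simp only [χ, Pi.add_apply, add_mul, Finset.sum_add_distrib, Pi.single_apply, ite_mul,
      one_mul, zero_mul, Finset.sum_ite_eq', Finset.mem_univ, if_true] at h2
    exact CharTwo.add_eq_zero.mp h2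

lemma exists_blockPairing_coloring {κ ι : Type*} [Fintype κ] [Fintype ι]
    (e : κ × Fin 2 ≃ ι × Fin 4) :
    ∃ (s : ι → Fin 4) (χ : ι × Fin 4 → ZMod 2),
      (∀ j, χ (e (j, 0)) + χ (e (j, 1)) = 1) ∧
      ∀ a, χ (blockPairing s (a, 0)) = χ (blockPairing s (a, 1)) := by
  obtain ⟨s, hs⟩ := exists_blockPairing_even e
  refine ⟨s, exists_coloring_of_even e (blockPairing s) fun P hP => hs P fun i => ?_⟩
  have h0 := hP (i, 0)
  have h1 := hP (i, 1)
  simp only [blockPairing_apply] at h0 h1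
  exact ⟨by simpa using h0, by simpa using h1⟩

/-- The paths `mate u, u, u', mate u'` over the edges `u u'` of `A` of colour `β` form a packing
that contains `M`. -/
lemma exists_path_packing_of_color {n m : ℕ} {ι : Type*} [Fintype ι] (w : Fin n → Fin n → ℝ)
    (hsymm : ∀ u v, w u v = w v u) (hn : n = 4 * m)
    (M : Fin (2 * m) × Fin 2 ≃ Fin n) (A : ι × Fin 2 ≃ Fin n) (χ : Fin n → ZMod 2)
    (hM : ∀ j, χ (M (j, 0)) + χ (M (j, 1)) = 1) (hA : ∀ a, χ (A (a, 0)) = χ (A (a, 1)))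
    (β : ZMod 2) :
    ∃ P : Fin m × Fin 4 ≃ Fin n,
      (∀ i : Fin (2 * m), ∃ (i' : Fin m) (j : Fin 4), (j : ℕ) + 1 < 4 ∧
        ((P (i', j) = M (i, 0) ∧ P (i', finRotate 4 j) = M (i, 1)) ∨
         (P (i', j) = M (i, 1) ∧ P (i', finRotate 4 j) = M (i, 0)))) ∧
      pathW w P = matchW w (fun q => M q) +
        ∑ a, if χ (A (a, 0)) = β then w (A (a, 0)) (A (a, 1)) else 0 := by
  classical
  have key : ∀ x y b : ZMod 2, x + y = 1 → (x = b ∧ y ≠ b) ∨ (x ≠ b ∧ y = b) := by decide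
  have hmate : ∀ v, χ v ≠ β → χ (mate M v) = β := fun v hv => by
    obtain ⟨j, rfl | rfl⟩ := exists_matching_edge M v
    · rw [mate_apply_zero]; exact ((key _ _ β (hM j)).resolve_left fun h => hv h.1).2
    · rw [mate_apply_one]; exact ((key _ _ β (hM j)).resolve_right fun h => hv h.2).1
  have hcard : Fintype.card {a // χ (A (a, 0)) = β} = m := by
    have h1 := sum_matching M fun v => if χ v = β then 1 else 0
    rw [sum_matching A] at h1
    have h2 : ∀ j, ((if χ (M (j, 0)) = β then 1 else 0) +
        if χ (M (j, 1)) = β then 1 else 0) = 1 := fun j => by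
      rcases key _ _ β (hM j) with h | h <;> simp [h]
    simp only [h2, ← hA, ← two_mul, ← Finset.mul_sum] at h1
    rw [Fintype.card_subtype, Finset.card_filter]
    simpa using h1
  let E : Fin m ≃ {a // χ (A (a, 0)) = β} := (Fintype.equivFinOfCardEq hcard).symm
  let F : Fin m × Fin 4 → Fin n := fun q =>
    ![mate M (A (E q.1, 0)), A (E q.1, 0), A (E q.1, 1), mate M (A (E q.1, 1))] q.2
  have hcover : ∀ v, χ v = β → ∃ l,
      (F (l, 1) = v ∧ F (l, 0) = mate M v) ∨ (F (l, 2) = v ∧ F (l, 3) = mate M v) := by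
    intro v hv
    obtain ⟨a, rfl | rfl⟩ := exists_matching_edge A v
    · exact ⟨E.symm ⟨a, hv⟩, Or.inl (by simp [F])⟩
    · exact ⟨E.symm ⟨a, (hA a).trans hv⟩, Or.inr (by simp [F])⟩
  have hsurj : Function.Surjective F := by
    intro v
    by_cases hv : χ v = β
    · obtain ⟨l, h | h⟩ := hcover v hv
      exacts [⟨_, h.1⟩, ⟨_, h.1⟩]
    · obtain ⟨l, h | h⟩ := hcover _ (hmate v hv)
      all_goals rw [mate_mate] at h
      exacts [⟨_, h.2⟩, ⟨_, h.2⟩]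
  have hbij : Function.Bijective F :=
    (Fintype.bijective_iff_surjective_and_card F).mpr ⟨hsurj, by simp [hn, mul_comm]⟩
  refine ⟨Equiv.ofBijective F hbij, fun i => ?_, ?_⟩
  · simp only [Equiv.ofBijective_apply]
    rcases key _ _ β (hM i) with h | h
    · obtain ⟨l, h | h⟩ := hcover _ h.1
      all_goals rw [mate_apply_zero] at h
      · exact ⟨l, 0, by decide, Or.inr ⟨h.2, h.1⟩⟩
      · exact ⟨l, 2, by decide, Or.inl ⟨h.1, h.2⟩⟩
    · obtain ⟨l, h | h⟩ := hcover _ h.2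
      all_goals rw [mate_apply_one] at h
      · exact ⟨l, 0, by decide, Or.inl ⟨h.2, h.1⟩⟩
      · exact ⟨l, 2, by decide, Or.inr ⟨h.1, h.2⟩⟩
  · have hmatch : matchW w (fun q => M q) =
        ∑ a, if χ (A (a, 0)) = β then
          w (A (a, 0)) (mate M (A (a, 0))) + w (A (a, 1)) (mate M (A (a, 1))) else 0 := by
      have h1 := sum_matching M fun v => if χ v = β then w v (mate M v) else 0
      rw [sum_matching A] at h1
      calc matchW w (fun q => M q) = _ := Finset.sum_congr rfl fun j _ => by
            simp only [mate_apply_zero, mate_apply_one]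
            rcases key _ _ β (hM j) with h | h <;> simp [h, hsymm (M (j, 1))]
        _ = _ := h1.symm
        _ = _ := Finset.sum_congr rfl fun a _ => by rw [← hA]; split_ifs <;> simp
    rw [hmatch, ← Finset.sum_add_distrib]
    have hpath : pathW w (Equiv.ofBijective F hbij) = ∑ l,
        (w (A (E l, 0)) (mate M (A (E l, 0))) + w (A (E l, 1)) (mate M (A (E l, 1))) +
          w (A (E l, 0)) (A (E l, 1))) := by
      refine Finset.sum_congr rfl fun l _ => ?_
      simp [Fin.sum_univ_four, F, hsymm (mate M _)]
      ring
    rw [hpath, E.sum_comp fun a : {a // χ (A (a, 0)) = β} =>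
      w (A (a, 0)) (mate M (A (a, 0))) + w (A (a, 1)) (mate M (A (a, 1))) +
        w (A (a, 0)) (A (a, 1))]
    rw [← Finset.sum_subtype (Finset.univ.filter fun a => χ (A (a, 0)) = β) (by simp)
      fun a => w (A (a, 0)) (mate M (A (a, 0))) + w (A (a, 1)) (mate M (A (a, 1))) +
        w (A (a, 0)) (A (a, 1)), Finset.sum_filter]
    exact Finset.sum_congr rfl fun a _ => by split_ifs <;> simp

lemma cycleW_eq_add_blockPairing {n m : ℕ} (w : Fin n → Fin n → ℝ)
    (C : Fin m × Fin 4 ≃ Fin n) (s : Fin m → Fin 4) :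
    cycleW w C =
      ∑ a, w (C (blockPairing s (a, 0))) (C (blockPairing s (a, 1))) +
      ∑ a, w (C (blockPairing (fun i => s i + 1) (a, 0)))
        (C (blockPairing (fun i => s i + 1) (a, 1))) := by
  simp only [Fintype.sum_prod_type, ← Finset.sum_add_distrib, cycleW, blockPairing_apply]
  refine Finset.sum_congr rfl fun i _ => ?_
  rw [← Equiv.sum_comp (Equiv.addLeft (s i))]
  generalize s i = t
  have h11 : (1 : Fin 4) + 1 = 2 := rfl
  have h21 : (2 : Fin 4) + 1 = 3 := rfl
  have h31 : (3 : Fin 4) + 1 = 0 := rfl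
  have h12 : (1 : Fin 4) + 2 = 3 := rfl
  have h13 : (1 : Fin 4) + 3 = 0 := rfl
  simp [Fin.sum_univ_four, finRotate_apply, add_assoc, h11, h21, h31, h12, h13]

lemma sum_le_matchW_of_max {n m : ℕ} (w : Fin n → Fin n → ℝ)
    (Mstar : Fin (2 * m) × Fin 2 ≃ Fin n)
    (hMmax : ∀ M : Fin (2 * m) × Fin 2 ≃ Fin n,
      matchW w (fun q => M q) ≤ matchW w (fun q => Mstar q))
    (A : (Fin m × Fin 2) × Fin 2 ≃ Fin n) :
    ∑ a, w (A (a, 0)) (A (a, 1)) ≤ matchW w (fun q => Mstar q) := by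
  let r : Fin (2 * m) ≃ Fin m × Fin 2 :=
    (finCongr (mul_comm 2 m)).trans finProdFinEquiv.symm
  refine le_of_eq_of_le ?_ (hMmax ((Equiv.prodCongr r (Equiv.refl (Fin 2))).trans A))
  rw [← r.sum_comp]
  rfl

/-- In a complete graph on `n = 4m` vertices with nonnegative edge weights,
there is a 4-path packing `P_4` whose edge set contains a maximum-weight perfect matching
`M*`, with `w(P_4) ≥ (1/2)·w(M*) + (1/2)·w(C*_4)`. -/
theorem stmt14 (n m : ℕ) (hn : n = 4 * m)
    (w : Fin n → Fin n → ℝ)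
    (hnonneg : ∀ u v, 0 ≤ w u v) (hsymm : ∀ u v, w u v = w v u)
    (Mstar : Fin (2 * m) × Fin 2 ≃ Fin n)
    (hMmax : ∀ M : Fin (2 * m) × Fin 2 ≃ Fin n,
      matchW w (fun q => M q) ≤ matchW w (fun q => Mstar q))
    (Cstar : Fin m × Fin 4 ≃ Fin n)
    (hCmax : ∀ C : Fin m × Fin 4 ≃ Fin n, cycleW w C ≤ cycleW w Cstar) :
    ∃ P : Fin m × Fin 4 ≃ Fin n,
      (∀ i : Fin (2 * m), ∃ (i' : Fin m) (j : Fin 4), (j : ℕ) + 1 < 4 ∧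
        ((P (i', j) = Mstar (i, 0) ∧ P (i', finRotate 4 j) = Mstar (i, 1)) ∨
         (P (i', j) = Mstar (i, 1) ∧ P (i', finRotate 4 j) = Mstar (i, 0)))) ∧
      pathW w P ≥
        (1 / 2) * matchW w (fun q => Mstar q) + (1 / 2) * cycleW w Cstar := by
  obtain ⟨s, χ, hχM, hχA⟩ := exists_blockPairing_coloring (Mstar.trans Cstar.symm)
  let A := (blockPairing s).trans Cstar
  have hA' := sum_le_matchW_of_max w Mstar hMmax
    ((blockPairing fun i => s i + 1).trans Cstar)
  have hC := cycleW_eq_add_blockPairing w Cstar s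
  have hpack := exists_path_packing_of_color w hsymm hn Mstar A (fun v => χ (Cstar.symm v))
    hχM (fun a => by simpa [A] using hχA a)
  obtain ⟨P₀, hP₀, hw₀⟩ := hpack 0
  obtain ⟨P₁, hP₁, hw₁⟩ := hpack 1
  have hsum : (∑ a, if χ (Cstar.symm (A (a, 0))) = 0 then w (A (a, 0)) (A (a, 1)) else 0) +
      (∑ a, if χ (Cstar.symm (A (a, 0))) = 1 then w (A (a, 0)) (A (a, 1)) else 0) =
      ∑ a, w (A (a, 0)) (A (a, 1)) := by
    rw [← Finset.sum_add_distrib]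
    refine Finset.sum_congr rfl fun a _ => ?_
    rcases zmod_two_cases (χ (Cstar.symm (A (a, 0)))) with h | h <;> simp [h]
  simp only [A, Equiv.trans_apply] at hsum hw₀ hw₁ hA'
  rcases le_total (pathW w P₀) (pathW w P₁) with h | h
  · exact ⟨P₁, hP₁, by linarith⟩
  · exact ⟨P₀, hP₀, by linarith⟩
end
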